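/- Let n ≥ 2, let 1 < p < n with p ≤ 2, and set p⋆ := np/(n−p). There exists a constant c = c(n,p) > 0 such that for every k ∈ ℕ ∪ {0}, every D ≥ 1 and every v ∈ C_c^∞(B_1(0)∖{0}), one has ∫_{B_1(0)} |x|^{p−n} |∇v|^p Y_{k+1}^{2−p}(|x|/D) Y_k^{−1}(|x|/D) dx ≥ c ( ∫_{B_1(0)} |x|^{−n} |v|^{p⋆} Y_k(|x|/D) X_{k+1}^{1+p⋆/p}(|x|/D) dx )^{p/p⋆}, where B_1(0) is the open unit ball in ℝ^n. -/

import Mathlib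

open MeasureTheory Real Set

noncomputable def X1 (t : ℝ) : ℝ := (1 - Real.log t)⁻¹

/-- Iterated logarithmic function: `XX 0 t = t`, `XX (k+1) t = X1 (XX k t)`;
so `XX 1 = X_1`, `XX 2 = X_2`, ... of the paper. -/
noncomputable def XX : ℕ → ℝ → ℝ
  | 0, t => t
  | k + 1, t => X1 (XX k t)

/-- `YY k t = ∏_{i=1}^k X_i(t)`, with `YY 0 = 1`. -/
noncomputable def YY (k : ℕ) (t : ℝ) : ℝ := ∏ i ∈ Finset.Icc 1 k, XX i t

/-- `ZZ k t = ∑_{i=1}^k Y_i(t)`, with `ZZ 0 = 0`. -/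
noncomputable def ZZ (k : ℕ) (t : ℝ) : ℝ := ∑ i ∈ Finset.Icc 1 k, YY i t

/-- The quantity `I_k[u; D]` of the paper. -/
noncomputable def Ik (n : ℕ) (p D : ℝ) (Ω : Set (EuclideanSpace ℝ (Fin n))) (k : ℕ)
    (u : EuclideanSpace ℝ (Fin n) → ℝ) : ℝ :=
  (∫ x in Ω, ‖fderiv ℝ u x‖ ^ p)
    - |((n : ℝ) - p) / p| ^ p * ∫ x in Ω, |u x| ^ p / ‖x‖ ^ p
    - ((p - 1) / (2 * p)) * |((n : ℝ) - p) / p| ^ (p - 2) *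
        ∫ x in Ω, (|u x| ^ p / ‖x‖ ^ p) * ∑ i ∈ Finset.Icc 1 k, (YY i (‖x‖ / D)) ^ 2

theorem tsupport_rpow_norm_subset {α F : Type*} [TopologicalSpace α] [NormedAddCommGroup F]
    (f : α → F) {p : ℝ}
    (hp : 0 < p) : tsupport (fun x ↦ ‖f x‖ ^ p) ⊆ tsupport f := by
  refine closure_mono fun x hx ↦ ?_
  contrapose! hx
  simp [Function.notMem_support.mp hx, hp.ne']

/-- A multiplicative form of Young's inequality with a small parameter. -/
theorem young_absorb {p a b : ℝ} (hp : 1 < p) (ha : 0 ≤ a) (hb : 0 ≤ b) :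
    p * a ^ (p - 1) * b ≤ a ^ p / 2 + p * (2 * p) ^ (p - 1) * b ^ p := by
  have key : ∀ c : ℝ, 0 ≤ c → c ^ (p - 1) * c = c ^ p := fun c hc ↦ by
    rw [← Real.rpow_add_one' hc (by linarith)]; ring_nf
  rcases le_total (2 * p * b) a with h | h
  · have h1 : p * a ^ (p - 1) * b ≤ a ^ p / 2 := by
      rw [← key a ha]
      have := mul_le_mul_of_nonneg_left h (Real.rpow_nonneg ha (p - 1))
      linarith
    have : 0 ≤ p * (2 * p) ^ (p - 1) * b ^ p := by positivity
    linarith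
  · have h1 : a ^ (p - 1) ≤ (2 * p) ^ (p - 1) * b ^ (p - 1) := by
      rw [← Real.mul_rpow (by positivity) hb]
      exact Real.rpow_le_rpow ha h (by linarith)
    have h2 : p * a ^ (p - 1) * b ≤ p * (2 * p) ^ (p - 1) * b ^ p := by
      rw [← key b hb]
      have := mul_le_mul_of_nonneg_right h1 hb
      nlinarith
    have : 0 ≤ a ^ p / 2 := by positivity
    linarith

theorem real_rpow_add_le {a b p : ℝ} (ha : 0 ≤ a) (hb : 0 ≤ b) (hp : 1 ≤ p) :
    (a + b) ^ p ≤ 2 ^ (p - 1) * (a ^ p + b ^ p) := by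
  lift a to NNReal using ha
  lift b to NNReal using hb
  exact_mod_cast NNReal.rpow_add_le_mul_rpow_add_rpow a b hp

section CKN
variable {E : Type*} [NormedAddCommGroup E] [InnerProductSpace ℝ E]

theorem hasFDerivAt_norm_rpow_of_ne_zero (s : ℝ) {y : E} (hy : y ≠ 0) :
    HasFDerivAt (fun x : E ↦ ‖x‖ ^ s) ((s * ‖y‖ ^ (s - 2)) • innerSL ℝ y) y := by
  apply HasStrictFDerivAt.hasFDerivAt
  convert! (hasStrictFDerivAt_norm_sq y).rpow_const (p := s / 2) (by simp [hy]) using 0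
  simp_rw [← Real.rpow_natCast_mul (norm_nonneg _), ← Nat.cast_smul_eq_nsmul ℝ, smul_smul]
  ring_nf

theorem contDiffAt_norm_rpow_of_ne_zero (s : ℝ) {y : E} (hy : y ≠ 0) :
    ContDiffAt ℝ 1 (fun x : E ↦ ‖x‖ ^ s) y :=
  (contDiffAt_norm ℝ hy).rpow_const_of_ne (norm_ne_zero_iff.mpr hy)

theorem contDiff_of_forall_mem_tsupport {f : E → ℝ}
    (h : ∀ x ∈ tsupport f, ContDiffAt ℝ 1 f x) : ContDiff ℝ 1 f := by
  refine contDiff_iff_contDiffAt.mpr fun x ↦ ?_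
  by_cases hx : x ∈ tsupport f
  · exact h x hx
  · exact contDiffAt_const.congr_of_eventuallyEq (notMem_tsupport_iff_eventuallyEq.mp hx)

theorem contDiff_norm_rpow_mul {f : E → ℝ} (hf : ContDiff ℝ 1 f) (h0 : (0 : E) ∉ tsupport f)
    (s : ℝ) : ContDiff ℝ 1 (fun x ↦ ‖x‖ ^ s * f x) := by
  refine contDiff_of_forall_mem_tsupport fun x hx ↦ ?_
  have hx' : x ∈ tsupport f := tsupport_mul_subset_right hx
  exact (contDiffAt_norm_rpow_of_ne_zero s (fun h ↦ h0 (h ▸ hx'))).mul hf.contDiffAt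

theorem continuous_norm_rpow_mul {f : E → ℝ} (hf : Continuous f) (h0 : (0 : E) ∉ tsupport f)
    (s : ℝ) : Continuous (fun x ↦ ‖x‖ ^ s * f x) := by
  refine continuous_of_tsupport fun x hx ↦ ?_
  have hx' : x ∈ tsupport f := tsupport_mul_subset_right hx
  exact (contDiffAt_norm_rpow_of_ne_zero s (fun h ↦ h0 (h ▸ hx'))).continuousAt.mul
    hf.continuousAt

variable [FiniteDimensional ℝ E] [MeasurableSpace E] [BorelSpace E] (μ : Measure E)
  [μ.IsAddHaarMeasure]

/-- The Euler vector field has divergence equal to the dimension. -/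
theorem integral_fderiv_apply_self {h : E → ℝ} (hh : ContDiff ℝ 1 h) (hc : HasCompactSupport h) :
    ∫ x, fderiv ℝ h x x ∂μ = -(Module.finrank ℝ E : ℝ) * ∫ x, h x ∂μ := by
  have hd : Continuous (fderiv ℝ h) := hh.continuous_fderiv one_ne_zero
  let b := stdOrthonormalBasis ℝ E
  have hint : ∀ i, Integrable (fun x ↦ inner ℝ (b i) x * fderiv ℝ h x (b i)) μ := fun i ↦ by
    refine Continuous.integrable_of_hasCompactSupport (by fun_prop) ?_
    exact ((hc.fderiv_apply (𝕜 := ℝ) (b i))).mul_left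
  have hi : ∀ i, ∫ x, inner ℝ (b i) x * fderiv ℝ h x (b i) ∂μ = -∫ x, h x ∂μ := fun i ↦ by
    have hf : ∀ x, fderiv ℝ (fun y ↦ inner ℝ (b i) y) x (b i) = 1 := fun x ↦ by
      have : (fun y ↦ inner ℝ (b i) y) = innerSL ℝ (b i) := by ext; simp
      rw [this, ContinuousLinearMap.fderiv]
      simp [b.norm_eq_one]
    rw [integral_mul_fderiv_eq_neg_fderiv_mul_of_integrable]
    · simp [hf]
    · simpa [hf] using hh.continuous.integrable_of_hasCompactSupport hc
    · exact hint i
    · exact Continuous.integrable_of_hasCompactSupport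
        (by have := hh.continuous; fun_prop) hc.mul_left
    · exact fun x _ ↦ (innerSL ℝ (b i)).differentiableAt
    · exact fun x _ ↦ hh.differentiable one_ne_zero x
  have hsum : ∀ x, fderiv ℝ h x x = ∑ i, inner ℝ (b i) x * fderiv ℝ h x (b i) := fun x ↦ by
    conv_lhs => rw [← b.sum_repr' x, map_sum]
    simp only [b.sum_repr' x, map_smul, smul_eq_mul]
  simp_rw [hsum]
  rw [integral_finsetSum _ fun i _ ↦ hint i]
  simp [hi]

/-- Hardy's inequality with the weights `‖x‖ ^ (1 - n)` and `‖x‖ ^ (p + 1 - n)`. -/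
theorem hardy_weighted {p : ℝ} (hp : 1 < p) {w : E → ℝ} (hw : ContDiff ℝ 1 w)
    (hc : HasCompactSupport w) (h0 : (0 : E) ∉ tsupport w) :
    ∫ x, ‖x‖ ^ (1 - (Module.finrank ℝ E : ℝ)) * |w x| ^ p ∂μ ≤
      2 * (p * (2 * p) ^ (p - 1)) *
        ∫ x, ‖x‖ ^ (p + 1 - (Module.finrank ℝ E : ℝ)) * ‖fderiv ℝ w x‖ ^ p ∂μ := by
  set N : ℝ := (Module.finrank ℝ E : ℝ)
  have hp0 : 0 < p := by linarith
  have hts := tsupport_rpow_norm_subset w hp0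
  have hts' : tsupport (fun x ↦ ‖fderiv ℝ w x‖ ^ p) ⊆ tsupport w :=
    (tsupport_rpow_norm_subset _ hp0).trans (tsupport_fderiv_subset ℝ)
  have hd : Continuous (fderiv ℝ w) := hw.continuous_fderiv one_ne_zero
  have hA : ContDiff ℝ 1 (fun x ↦ ‖x‖ ^ (1 - N) * ‖w x‖ ^ p) :=
    contDiff_norm_rpow_mul (hw.norm_rpow hp) (fun h ↦ h0 (hts h)) _
  have hAc : HasCompactSupport (fun x ↦ ‖x‖ ^ (1 - N) * ‖w x‖ ^ p) :=
    (hc.mono' (subset_closure.trans hts)).mul_left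
  have hB : Integrable (fun x ↦ ‖x‖ ^ (p + 1 - N) * ‖fderiv ℝ w x‖ ^ p) μ := by
    refine Continuous.integrable_of_hasCompactSupport ?_
      (hc.mono' (subset_closure.trans hts')).mul_left
    exact continuous_norm_rpow_mul (hd.norm.rpow_const fun _ ↦ .inr hp0.le)
      (fun h ↦ h0 (hts' h)) _
  have hpt : ∀ x, -(fderiv ℝ (fun x ↦ ‖x‖ ^ (1 - N) * ‖w x‖ ^ p) x x) ≤
      (N - 1 + 1 / 2) * (‖x‖ ^ (1 - N) * ‖w x‖ ^ p) +
        p * (2 * p) ^ (p - 1) * (‖x‖ ^ (p + 1 - N) * ‖fderiv ℝ w x‖ ^ p) := by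
    intro x
    by_cases hx : x ∈ tsupport w
    · have hx0 : x ≠ 0 := fun h ↦ h0 (h ▸ hx)
      have hxp : 0 < ‖x‖ := norm_pos_iff.mpr hx0
      have h1 := hasFDerivAt_norm_rpow_of_ne_zero (1 - N) hx0
      have h2 := ((hw.norm_rpow hp).differentiable one_ne_zero x).hasFDerivAt
      have h3 := norm_fderiv_norm_rpow_le (hw.differentiable one_ne_zero) (x := x) hp
      rw [fderiv_fun_mul h1.differentiableAt h2.differentiableAt, h1.fderiv]
      have h4 : -(fderiv ℝ (fun x ↦ ‖w x‖ ^ p) x x) ≤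
          p * ‖w x‖ ^ (p - 1) * (‖x‖ * ‖fderiv ℝ w x‖) := by
        have := (fderiv ℝ (fun x ↦ ‖w x‖ ^ p) x).le_of_opNorm_le h3 x
        rw [Real.norm_eq_abs] at this
        have := (neg_le_abs _).trans this
        linarith
      have h5 := h4.trans (young_absorb hp (norm_nonneg (w x)) (by positivity))
      have h6 := mul_le_mul_of_nonneg_left h5 (Real.rpow_nonneg (norm_nonneg x) (1 - N))
      have e1 : ‖x‖ ^ (1 - N) = ‖x‖ ^ (1 - N - 2) * (‖x‖ * ‖x‖) := by
        rw [← pow_two, ← Real.rpow_natCast, ← Real.rpow_add hxp]; congr 1; push_cast; ring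
      have e2 : ‖x‖ ^ (p + 1 - N) = ‖x‖ ^ (1 - N) * ‖x‖ ^ p := by
        rw [← Real.rpow_add hxp]; congr 1; ring
      have e3 : (‖x‖ * ‖fderiv ℝ w x‖) ^ p = ‖x‖ ^ p * ‖fderiv ℝ w x‖ ^ p :=
        Real.mul_rpow (norm_nonneg _) (norm_nonneg _)
      rw [e3] at h6
      rw [e2]
      simp only [add_apply, smul_apply, smul_eq_mul,
        innerSL_apply_apply, real_inner_self_eq_norm_mul_norm]
      have e4 : ‖w x‖ ^ p * ((1 - N) * ‖x‖ ^ (1 - N - 2) * (‖x‖ * ‖x‖)) =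
        (1 - N) * (‖x‖ ^ (1 - N) * ‖w x‖ ^ p) := by rw [e1]; ring
      rw [e4]
      linarith
    · have hz : fderiv ℝ (fun x ↦ ‖x‖ ^ (1 - N) * ‖w x‖ ^ p) x = 0 := by
        by_contra hne
        refine hx (hts (tsupport_mul_subset_right (tsupport_fderiv_subset ℝ
          (subset_tsupport _ hne))))
      have hwz : w x = 0 := image_eq_zero_of_notMem_tsupport hx
      rw [hz]
      simp only [hwz, norm_zero, Real.zero_rpow hp0.ne']
      simp only [zero_apply, neg_zero, mul_zero, zero_add]
      positivity
  have hint := hA.continuous.integrable_of_hasCompactSupport hAc (μ := μ)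
  have hint' : Integrable (fun x ↦ fderiv ℝ (fun x ↦ ‖x‖ ^ (1 - N) * ‖w x‖ ^ p) x x) μ := by
    refine Continuous.integrable_of_hasCompactSupport ?_ ?_
    · exact (hA.continuous_fderiv one_ne_zero).clm_apply continuous_id
    · refine (hAc.fderiv (𝕜 := ℝ)).mono fun x hx ↦ ?_
      contrapose! hx
      rw [Function.notMem_support, Function.notMem_support.mp hx, zero_apply]
  have key := integral_mono hint'.neg ((hint.const_mul (N - 1 + 1 / 2)).add
    (hB.const_mul (p * (2 * p) ^ (p - 1)))) hpt
  simp only [Pi.neg_apply, Pi.add_apply] at key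
  rw [integral_neg, integral_fderiv_apply_self μ hA hAc, integral_add (hint.const_mul _)
    (hB.const_mul _), integral_const_mul, integral_const_mul] at key
  simp only [← Real.norm_eq_abs]
  linarith

/-- The Caffarelli–Kohn–Nirenberg inequality with weights `‖x‖ ^ (p + 1 - n)` and
`‖x‖ ^ (q / p - n)`, where `q` is the Sobolev conjugate of `p`. -/
theorem exists_ckn_weighted {p q : ℝ} (hp : 1 < p) (hq : 0 < q)
    (hN : 0 < Module.finrank ℝ E)
    (hpq : q⁻¹ = p⁻¹ - (Module.finrank ℝ E : ℝ)⁻¹) :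
    ∃ C : ℝ, 0 < C ∧ ∀ w : E → ℝ, ContDiff ℝ 1 w → HasCompactSupport w →
      (0 : E) ∉ tsupport w →
      (∫ x, ‖x‖ ^ (q / p - (Module.finrank ℝ E : ℝ)) * |w x| ^ q ∂μ) ^ (p / q) ≤
        C * ∫ x, ‖x‖ ^ (p + 1 - (Module.finrank ℝ E : ℝ)) * ‖fderiv ℝ w x‖ ^ p ∂μ := by
  set N : ℝ := (Module.finrank ℝ E : ℝ) with hNdef
  have hp0 : 0 < p := by linarith
  set α : ℝ := (p + 1 - N) / p with hα
  set S : ℝ := (SNormLESNormFDerivOfEqConst ℝ μ p : ℝ)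
  set H : ℝ := 2 * (p * (2 * p) ^ (p - 1))
  have hS : 0 ≤ S := NNReal.coe_nonneg _
  have hH : 0 < H := by positivity
  refine ⟨(S ^ p + 1) * (2 ^ (p - 1) * (|α| ^ p * H + 1)), by positivity, fun w hw hc h0 ↦ ?_⟩
  have hu : ContDiff ℝ 1 (fun x ↦ ‖x‖ ^ α * w x) := contDiff_norm_rpow_mul hw h0 α
  have huc : HasCompactSupport (fun x ↦ ‖x‖ ^ α * w x) := hc.mul_left
  have hdu : Continuous (fderiv ℝ (fun x ↦ ‖x‖ ^ α * w x)) := hu.continuous_fderiv one_ne_zero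
  have hd : Continuous (fderiv ℝ w) := hw.continuous_fderiv one_ne_zero
  have hts := tsupport_rpow_norm_subset w hp0
  have hts' : tsupport (fun x ↦ ‖fderiv ℝ w x‖ ^ p) ⊆ tsupport w :=
    (tsupport_rpow_norm_subset _ hp0).trans (tsupport_fderiv_subset ℝ)
  have hxα : ∀ x ∈ tsupport w, 0 < ‖x‖ := fun x hx ↦
    norm_pos_iff.mpr fun h ↦ h0 (h ▸ hx)
  -- the unweighted Sobolev inequality for `‖x‖ ^ α * w x`
  have sob : (∫ x, ‖‖x‖ ^ α * w x‖ ^ q ∂μ) ^ (p / q) ≤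
      S ^ p * ∫ x, ‖fderiv ℝ (fun x ↦ ‖x‖ ^ α * w x) x‖ ^ p ∂μ := by
    have h := eLpNorm_le_eLpNorm_fderiv_of_eq μ hu huc (p := p.toNNReal) (p' := q.toNNReal)
      (by simpa using hp.le) hN (by simpa [hp0.le, hq.le] using hpq)
    have hp' : ((p.toNNReal : NNReal) : ENNReal) ≠ 0 := by simpa using hp0
    have hq' : ((q.toNNReal : NNReal) : ENNReal) ≠ 0 := by simpa using hq
    rw [(hu.continuous.memLp_of_hasCompactSupport huc).eLpNorm_eq_integral_rpow_norm hq'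
      ENNReal.coe_ne_top,
      (hdu.memLp_of_hasCompactSupport (huc.fderiv (𝕜 := ℝ))).eLpNorm_eq_integral_rpow_norm hp'
      ENNReal.coe_ne_top] at h
    simp only [ENNReal.coe_toReal, Real.coe_toNNReal _ hp0.le, Real.coe_toNNReal _ hq.le] at h
    rw [← ENNReal.ofReal_coe_nnreal, ← ENNReal.ofReal_mul hS,
      ENNReal.ofReal_le_ofReal_iff (by positivity)] at h
    have h' := Real.rpow_le_rpow (by positivity) h hp0.le
    rw [Real.mul_rpow hS (by positivity), ← Real.rpow_mul (by positivity),
      ← Real.rpow_mul (by positivity), inv_mul_cancel₀ hp0.ne', Real.rpow_one,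
      inv_mul_eq_div] at h'
    exact h'
  have hlhs : ∀ x, ‖x‖ ^ (q / p - N) * |w x| ^ q = ‖‖x‖ ^ α * w x‖ ^ q := fun x ↦ by
    by_cases hx : x ∈ tsupport w
    · rw [norm_mul, Real.mul_rpow (norm_nonneg _) (norm_nonneg _), Real.norm_eq_abs,
        Real.norm_eq_abs, abs_of_nonneg (Real.rpow_nonneg (norm_nonneg x) α), ← Real.rpow_mul (norm_nonneg _)]
      congr 2
      have hN' : N ≠ 0 := by rw [hNdef]; exact_mod_cast hN.ne'
      have : N * p = q * (N - p) := by field_simp at hpq; linarith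
      rw [hα]; field_simp; linarith
    · simp [image_eq_zero_of_notMem_tsupport hx, hq.ne']
  have hA : Integrable (fun x ↦ ‖x‖ ^ (1 - N) * |w x| ^ p) μ :=
    (contDiff_norm_rpow_mul (hw.norm_rpow hp) (fun h ↦ h0 (hts h)) _).continuous
      |>.integrable_of_hasCompactSupport (hc.mono' (subset_closure.trans hts)).mul_left
  have hB : Integrable (fun x ↦ ‖x‖ ^ (p + 1 - N) * ‖fderiv ℝ w x‖ ^ p) μ :=
    (continuous_norm_rpow_mul (hd.norm.rpow_const fun _ ↦ .inr hp0.le)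
      (fun h ↦ h0 (hts' h)) _).integrable_of_hasCompactSupport
      (hc.mono' (subset_closure.trans hts')).mul_left
  have hpt : ∀ x, ‖fderiv ℝ (fun x ↦ ‖x‖ ^ α * w x) x‖ ^ p ≤
      2 ^ (p - 1) * (|α| ^ p * (‖x‖ ^ (1 - N) * |w x| ^ p) +
        ‖x‖ ^ (p + 1 - N) * ‖fderiv ℝ w x‖ ^ p) := fun x ↦ by
    by_cases hx : x ∈ tsupport w
    · have hx0 := hxα x hx
      have h1 := hasFDerivAt_norm_rpow_of_ne_zero α (norm_pos_iff.mp hx0)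
      have h2 : ‖fderiv ℝ (fun x ↦ ‖x‖ ^ α * w x) x‖ ≤
          |α| * ‖x‖ ^ (α - 1) * |w x| + ‖x‖ ^ α * ‖fderiv ℝ w x‖ := by
        rw [fderiv_fun_mul h1.differentiableAt (hw.differentiable one_ne_zero x), h1.fderiv,
          add_comm]
        refine (norm_add_le _ _).trans (add_le_add (le_of_eq ?_) (le_of_eq ?_))
        · rw [norm_smul, norm_smul, innerSL_apply_norm, norm_mul, Real.norm_eq_abs,
            Real.norm_eq_abs, Real.norm_eq_abs, abs_of_nonneg (by positivity : 0 ≤ ‖x‖ ^ (α - 2)),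
            show α - 1 = (α - 2) + 1 by ring, Real.rpow_add_one hx0.ne']
          ring
        · rw [norm_smul, Real.norm_eq_abs, abs_of_nonneg (by positivity)]
      refine (Real.rpow_le_rpow (norm_nonneg _) h2 hp0.le).trans
        ((real_rpow_add_le (by positivity) (by positivity) hp.le).trans_eq ?_)
      rw [Real.mul_rpow (by positivity) (by positivity), Real.mul_rpow (by positivity)
        (by positivity), Real.mul_rpow (by positivity) (by positivity),
        ← Real.rpow_mul (norm_nonneg _), ← Real.rpow_mul (norm_nonneg _),
        show (α - 1) * p = 1 - N by rw [hα]; field_simp; ring,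
        show α * p = p + 1 - N by rw [hα]; field_simp]
      ring
    · have hz : fderiv ℝ (fun x ↦ ‖x‖ ^ α * w x) x = 0 := by
        by_contra hne
        exact hx (tsupport_mul_subset_right (tsupport_fderiv_subset ℝ (subset_tsupport _ hne)))
      rw [hz, norm_zero, Real.zero_rpow hp0.ne']
      positivity
  have hint := integral_mono
    ((hdu.norm.rpow_const fun _ ↦ .inr hp0.le).integrable_of_hasCompactSupport
      ((huc.fderiv (𝕜 := ℝ)).mono' (subset_closure.trans (tsupport_rpow_norm_subset _ hp0))))
    (((hA.const_mul (|α| ^ p)).add hB).const_mul (2 ^ (p - 1))) hpt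
  simp only [Pi.add_apply] at hint
  rw [integral_const_mul, integral_add (hA.const_mul _) hB, integral_const_mul] at hint
  have hardy := hardy_weighted μ hp hw hc h0
  rw [← hNdef] at hardy
  simp_rw [hlhs]
  set I := ∫ x, ‖x‖ ^ (p + 1 - N) * ‖fderiv ℝ w x‖ ^ p ∂μ
  have hI : 0 ≤ I := by positivity
  calc _ ≤ S ^ p * ∫ x, ‖fderiv ℝ (fun x ↦ ‖x‖ ^ α * w x) x‖ ^ p ∂μ := sob
    _ ≤ (S ^ p + 1) * (2 ^ (p - 1) * (|α| ^ p * (H * I) + I)) := by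
        gcongr
        · linarith
        · exact hint.trans (by gcongr)
    _ = _ := by ring

end CKN

section IteratedLog

theorem XX_succ_eq_comp (k : ℕ) (t : ℝ) : XX (k + 1) t = XX k (X1 t) := by
  induction k with
  | zero => rfl
  | succ k ih => rw [XX, ih, XX]

theorem YY_succ (k : ℕ) (t : ℝ) : YY (k + 1) t = YY k t * XX (k + 1) t :=
  Finset.prod_Icc_succ_top (by omega) _

theorem YY_succ_eq_comp (k : ℕ) (t : ℝ) : YY (k + 1) t = X1 t * YY k (X1 t) := by
  induction k with
  | zero => simp [YY, XX]
  | succ k ih => rw [YY_succ, ih, XX_succ_eq_comp (k + 1), YY_succ k (X1 t), mul_assoc]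

theorem XX_mem_Ioc (k : ℕ) {t : ℝ} (ht : t ∈ Ioc 0 1) : XX k t ∈ Ioc 0 1 := by
  induction k with
  | zero => exact ht
  | succ k ih =>
    have := Real.log_nonpos ih.1.le ih.2
    exact ⟨inv_pos.mpr (by linarith), inv_le_one_of_one_le₀ (by linarith)⟩

theorem YY_mem_Ioc (k : ℕ) {t : ℝ} (ht : t ∈ Ioc 0 1) : YY k t ∈ Ioc 0 1 :=
  ⟨Finset.prod_pos fun _ _ ↦ (XX_mem_Ioc _ ht).1,
    Finset.prod_le_one (fun _ _ ↦ (XX_mem_Ioc _ ht).1.le) fun _ _ ↦ (XX_mem_Ioc _ ht).2⟩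

theorem continuousAt_XX (k : ℕ) {t : ℝ} (ht : t ∈ Ioc 0 1) : ContinuousAt (XX k) t := by
  induction k with
  | zero => exact continuousAt_id
  | succ k ih =>
    have h := XX_mem_Ioc k ht
    have := Real.log_nonpos h.1.le h.2
    exact (continuousAt_const.sub (ih.log h.1.ne')).inv₀
      (show 1 - Real.log (XX k t) ≠ 0 by linarith)

theorem continuousAt_YY (k : ℕ) {t : ℝ} (ht : t ∈ Ioc 0 1) : ContinuousAt (YY k) t :=
  tendsto_finsetProd _ fun i _ ↦ continuousAt_XX i ht

/-- The iterates of `q ↦ exp (1 - 1 / q)`, which invert the functions `XX k`. -/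
noncomputable def invXX : ℕ → ℝ → ℝ
  | 0, q => q
  | k + 1, q => Real.exp (1 - (invXX k q)⁻¹)

theorem X1_exp (q : ℝ) : X1 (Real.exp (1 - q⁻¹)) = q := by simp [X1]

theorem invXX_succ_eq_comp (k : ℕ) (q : ℝ) :
    invXX (k + 1) q = invXX k (Real.exp (1 - q⁻¹)) := by
  induction k with
  | zero => rfl
  | succ k ih => rw [invXX, ih, invXX]

theorem XX_invXX (k : ℕ) (q : ℝ) : XX k (invXX k q) = q := by
  induction k with
  | zero => rfl
  | succ k ih => rw [XX_succ_eq_comp, invXX, X1_exp, ih]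

theorem invXX_XX (k : ℕ) {t : ℝ} (ht : t ∈ Ioc 0 1) : invXX k (XX k t) = t := by
  induction k with
  | zero => rfl
  | succ k ih =>
    have h : Real.exp (1 - (X1 (XX k t))⁻¹) = XX k t := by
      simp [X1, Real.exp_log (XX_mem_Ioc k ht).1]
    rw [invXX_succ_eq_comp, XX, h, ih]

theorem invXX_pos (k : ℕ) {q : ℝ} (hq : 0 < q) : 0 < invXX k q := by
  cases k with
  | zero => exact hq
  | succ k => exact Real.exp_pos _

theorem hasDerivAt_invXX (k : ℕ) {q : ℝ} (hq : 0 < q) :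
    HasDerivAt (invXX k) (invXX k q / (q * YY k (invXX k q))) q := by
  induction k with
  | zero => simpa [invXX, YY, hq.ne'] using! hasDerivAt_id q
  | succ k ih =>
    have h0 := invXX_pos k hq
    have := ((ih.inv h0.ne').const_sub 1).exp
    have e : invXX (k + 1) q / (q * YY (k + 1) (invXX (k + 1) q)) =
        Real.exp (1 - (invXX k q)⁻¹) *
          -(-(invXX k q / (q * YY k (invXX k q))) / invXX k q ^ 2) := by
      rw [YY_succ_eq_comp, invXX, X1_exp]
      field_simp
    rw [e]
    exact this

theorem contDiffAt_invXX (k : ℕ) {q : ℝ} (hq : 0 < q) : ContDiffAt ℝ 1 (invXX k) q := by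
  induction k with
  | zero => exact contDiffAt_id
  | succ k ih => exact (contDiffAt_const.sub (ih.inv (invXX_pos k hq).ne')).exp

end IteratedLog

section Radial
variable {E : Type*} [NormedAddCommGroup E] [InnerProductSpace ℝ E]

/-- The radial map with profile `R`. -/
noncomputable def radialMap (R : ℝ → ℝ) (y : E) : E := (R ‖y‖ / ‖y‖) • y

/-- The derivative of `radialMap R` when `R` has derivative `R'` at `‖y‖`. -/
noncomputable def radialFDeriv (R : ℝ → ℝ) (R' : ℝ) (y : E) : E →L[ℝ] E :=
  (R ‖y‖ / ‖y‖) • ContinuousLinearMap.id ℝ E +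
    (((R' - R ‖y‖ / ‖y‖) / ‖y‖ ^ 2) • innerSL ℝ y).smulRight y

theorem norm_radialMap {R : ℝ → ℝ} {y : E} (hy : y ≠ 0) (hR : 0 ≤ R ‖y‖) :
    ‖radialMap R y‖ = R ‖y‖ := by
  rw [radialMap, norm_smul, Real.norm_eq_abs, abs_of_nonneg (by positivity),
    div_mul_cancel₀ _ (norm_ne_zero_iff.mpr hy)]

theorem hasFDerivAt_radialMap {R : ℝ → ℝ} {R' : ℝ} {y : E} (hy : y ≠ 0)
    (hR : HasDerivAt R R' ‖y‖) : HasFDerivAt (radialMap R) (radialFDeriv R R' y) y := by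
  have hy' : ‖y‖ ≠ 0 := norm_ne_zero_iff.mpr hy
  have h1 : HasFDerivAt (fun x : E ↦ ‖x‖) (‖y‖⁻¹ • innerSL ℝ y) y := by
    have := hasFDerivAt_norm_rpow_of_ne_zero 1 hy
    norm_num [Real.rpow_neg_one] at this
    exact this
  have h2 := (hR.div (hasDerivAt_id _) hy').comp_hasFDerivAt y h1
  refine (h2.smul (hasFDerivAt_id y)).congr_fderiv ?_
  rw [radialFDeriv]
  congr 2
  rw [smul_smul]
  congr 1
  simp only [id]
  field_simp

theorem norm_radialFDeriv_le {R : ℝ → ℝ} {R' : ℝ} {y : E} (hy : y ≠ 0) (hR : 0 ≤ R ‖y‖)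
    (hR' : R ‖y‖ / ‖y‖ ≤ R') : ‖radialFDeriv R R' y‖ ≤ R' := by
  have hy' : 0 < ‖y‖ := norm_pos_iff.mpr hy
  have h0 : 0 ≤ R ‖y‖ / ‖y‖ := by positivity
  have h1 : 0 ≤ (R' - R ‖y‖ / ‖y‖) / ‖y‖ ^ 2 := div_nonneg (by linarith) (by positivity)
  calc _ ≤ R ‖y‖ / ‖y‖ * 1 + (R' - R ‖y‖ / ‖y‖) / ‖y‖ ^ 2 * ‖y‖ * ‖y‖ := by
        refine (norm_add_le _ _).trans (add_le_add ?_ ?_)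
        · rw [norm_smul, Real.norm_eq_abs, abs_of_nonneg h0]
          gcongr
          exact ContinuousLinearMap.norm_id_le
        · rw [ContinuousLinearMap.norm_smulRight_apply, norm_smul, innerSL_apply_norm,
            Real.norm_eq_abs, abs_of_nonneg h1]
    _ = R' := by field_simp; ring

theorem det_radialFDeriv [FiniteDimensional ℝ E] {R : ℝ → ℝ} {R' : ℝ} {y : E} (hy : y ≠ 0)
    (hR : R ‖y‖ ≠ 0) : (radialFDeriv R R' y).det =
      (R ‖y‖ / ‖y‖) ^ Module.finrank ℝ E * (R' / (R ‖y‖ / ‖y‖)) := by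
  have hy' : ‖y‖ ≠ 0 := norm_ne_zero_iff.mpr hy
  set a := R ‖y‖ / ‖y‖ with ha
  have ha0 : a ≠ 0 := div_ne_zero hR hy'
  have : ((radialFDeriv R R' y : E →L[ℝ] E) : E →ₗ[ℝ] E) =
      a • LinearMap.transvection (((R' - a) / ‖y‖ ^ 2 / a) • (innerSL ℝ y : E →ₗ[ℝ] ℝ)) y := by
    ext z
    simp [radialFDeriv, LinearMap.transvection.apply, ← ha, smul_smul]
    congr 1
    field_simp
  rw [ContinuousLinearMap.det, this, LinearMap.det_smul, LinearMap.transvection.det]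
  congr 1
  simp
  field_simp
  ring

theorem contDiffAt_radialMap {R : ℝ → ℝ} {y : E} (hy : y ≠ 0)
    (hR : ContDiffAt ℝ 1 R ‖y‖) : ContDiffAt ℝ 1 (radialMap R) y := by
  have hn : ContDiffAt ℝ 1 (fun x : E ↦ ‖x‖) y := contDiffAt_norm ℝ hy
  exact ((hR.comp y hn).div hn (norm_ne_zero_iff.mpr hy)).smul contDiffAt_id

theorem radialMap_comp {R P : ℝ → ℝ} {y : E} (hy : y ≠ 0) (hR : 0 < R ‖y‖)
    (h : P (R ‖y‖) = ‖y‖) : radialMap P (radialMap R y) = y := by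
  have hy' : ‖y‖ ≠ 0 := norm_ne_zero_iff.mpr hy
  rw [radialMap, norm_radialMap hy hR.le, h, radialMap, smul_smul]
  have : ‖y‖ / R ‖y‖ * (R ‖y‖ / ‖y‖) = 1 := by field_simp
  rw [this, one_smul]

end Radial

/-- The critical weighted Caffarelli–Kohn–Nirenberg-type inequality (eq. (3.1) of the paper),
case `1 < p ≤ 2`, `p < n`. -/
theorem ckn_critical (n : ℕ) (hn : 2 ≤ n) (p : ℝ) (hp1 : 1 < p) (hp2 : p ≤ 2)
    (hpn : p < n) (pstar : ℝ) (hps : pstar = n * p / (n - p)) :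
    ∃ c : ℝ, 0 < c ∧
      ∀ (k : ℕ) (D : ℝ), 1 ≤ D →
        ∀ v : EuclideanSpace ℝ (Fin n) → ℝ,
          ContDiff ℝ (⊤ : ℕ∞) v → HasCompactSupport v →
          tsupport v ⊆ Metric.ball (0 : EuclideanSpace ℝ (Fin n)) 1 \ {0} →
          (∫ x in Metric.ball (0 : EuclideanSpace ℝ (Fin n)) 1,
              ‖x‖ ^ (p - n) * ‖fderiv ℝ v x‖ ^ p * (YY (k + 1) (‖x‖ / D)) ^ (2 - p) *
                (YY k (‖x‖ / D)) ^ (-1 : ℝ)) ≥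
            c * (∫ x in Metric.ball (0 : EuclideanSpace ℝ (Fin n)) 1,
                ‖x‖ ^ (-(n : ℝ)) * |v x| ^ pstar * YY k (‖x‖ / D) *
                  (XX (k + 1) (‖x‖ / D)) ^ (1 + pstar / p)) ^ (p / pstar) := by
  have hn0 : (0 : ℝ) < n := by positivity
  have hp0 : 0 < p := by linarith
  have hnp : 0 < (n : ℝ) - p := by linarith
  have hq : 0 < pstar := by rw [hps]; positivity
  have hfr : Module.finrank ℝ (EuclideanSpace ℝ (Fin n)) = n := by simp
  obtain ⟨C, hC, hckn⟩ := exists_ckn_weighted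
    (volume : Measure (EuclideanSpace ℝ (Fin n))) (p := p) (q := pstar) hp1 hq
    (by rw [hfr]; omega) (by rw [hfr, hps]; field_simp)
  simp only [hfr] at hckn
  refine ⟨C⁻¹, inv_pos.mpr hC, fun k D hD v hv hvc hvs ↦ ?_⟩
  have : Nontrivial (EuclideanSpace ℝ (Fin n)) :=
    Module.nontrivial_of_finrank_pos (R := ℝ) (by rw [hfr]; omega)
  have hD0 : 0 < D := by linarith
  set R : ℝ → ℝ := fun ρ ↦ D * invXX (k + 1) ρ with hRdef
  set P : ℝ → ℝ := fun r ↦ XX (k + 1) (r / D) with hPdef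
  set R' : ℝ → ℝ := fun ρ ↦ R ρ / (ρ * YY (k + 1) (R ρ / D)) with hR'def
  have hIoc : ∀ r : ℝ, 0 < r → r < 1 → r / D ∈ Ioc 0 1 := fun r h h' ↦
    ⟨by positivity, (div_le_one hD0).mpr (by linarith)⟩
  have hRpos : ∀ ρ, 0 < ρ → 0 < R ρ := fun ρ h ↦ mul_pos hD0 (invXX_pos _ h)
  have hRD : ∀ ρ, R ρ / D = invXX (k + 1) ρ := fun ρ ↦ by simp [hRdef, hD0.ne']
  have hPR : ∀ ρ, P (R ρ) = ρ := fun ρ ↦ by simp only [hPdef, hRD, XX_invXX]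
  have hRP : ∀ r, 0 < r → r < 1 → R (P r) = r := fun r h h' ↦ by
    simp only [hRdef, hPdef, invXX_XX _ (hIoc r h h')]
    field_simp
  have hPpos : ∀ r, 0 < r → r < 1 → 0 < P r := fun r h h' ↦ (XX_mem_Ioc _ (hIoc r h h')).1
  have hRder : ∀ ρ, 0 < ρ → HasDerivAt R (R' ρ) ρ := fun ρ h ↦ by
    have := (hasDerivAt_invXX (k + 1) h).const_mul D
    simp only [hR'def, hRD]
    rw [hRdef, mul_div_assoc]
    exact this
  set Φ : EuclideanSpace ℝ (Fin n) → EuclideanSpace ℝ (Fin n) := radialMap R with hΦ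
  set A : Set (EuclideanSpace ℝ (Fin n)) := {y | y ≠ 0 ∧ R ‖y‖ < 1}
  have hΦnorm : ∀ y, y ≠ 0 → ‖Φ y‖ = R ‖y‖ := fun y hy ↦
    norm_radialMap hy (hRpos _ (norm_pos_iff.mpr hy)).le
  have hΦder : ∀ y, y ≠ 0 → HasFDerivAt Φ (radialFDeriv R (R' ‖y‖) y) y := fun y hy ↦
    hasFDerivAt_radialMap hy (hRder _ (norm_pos_iff.mpr hy))
  have hΨΦ : ∀ y, y ≠ 0 → radialMap P (Φ y) = y := fun y hy ↦
    radialMap_comp hy (hRpos _ (norm_pos_iff.mpr hy)) (hPR _)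
  have hΦ0 : ∀ y, Φ y ≠ 0 → y ≠ 0 := fun y hy h ↦ hy (by simp [hΦ, h, radialMap])
  have hAmem : ∀ y, Φ y ∈ Metric.ball 0 1 \ {0} → y ∈ A := fun y hy ↦ by
    have h0 := hΦ0 y hy.2
    exact ⟨h0, by simpa [hΦnorm y h0] using hy.1⟩
  have hΨne : ∀ x ∈ Metric.ball (0 : EuclideanSpace ℝ (Fin n)) 1 \ {0},
      radialMap P x ≠ 0 ∧ Φ (radialMap P x) = x := fun x hx ↦ by
    have hx0 : 0 < ‖x‖ := norm_pos_iff.mpr hx.2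
    have hx1 : ‖x‖ < 1 := by simpa using hx.1
    have hP := hPpos _ hx0 hx1
    refine ⟨norm_pos_iff.mp ?_, radialMap_comp hx.2 hP (hRP _ hx0 hx1)⟩
    rw [norm_radialMap hx.2 hP.le]
    exact hP
  have himage : Φ '' A = Metric.ball 0 1 \ {0} := by
    ext x
    constructor
    · rintro ⟨y, ⟨hy, hy1⟩, rfl⟩
      have h := hΦnorm y hy
      refine ⟨by simpa [h] using hy1, norm_pos_iff.mp ?_⟩
      rw [h]
      exact hRpos _ (norm_pos_iff.mpr hy)
    · intro hx
      exact ⟨radialMap P x, hAmem _ (by rwa [(hΨne x hx).2]), (hΨne x hx).2⟩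
  have hinj : InjOn Φ A := fun y hy z hz h ↦ by
    rw [← hΨΦ y hy.1, ← hΨΦ z hz.1, h]
  have hAmeas : MeasurableSet A := by
    refine IsOpen.measurableSet (isOpen_iff_mem_nhds.mpr fun y hy ↦ ?_)
    have h1 : ContinuousAt (fun z : EuclideanSpace ℝ (Fin n) ↦ R ‖z‖) y :=
      (hRder _ (norm_pos_iff.mpr hy.1)).continuousAt.comp continuous_norm.continuousAt
    filter_upwards [isOpen_ne.mem_nhds hy.1, h1.eventually_lt_const hy.2] with z hz1 hz2
    exact ⟨hz1, hz2⟩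
  have hball : ∀ F : EuclideanSpace ℝ (Fin n) → ℝ,
      ∫ x in Metric.ball 0 1, F x = ∫ y in A, |(radialFDeriv R (R' ‖y‖) y).det| • F (Φ y) := by
    intro F
    rw [← integral_image_eq_integral_abs_det_fderiv_smul volume hAmeas
      (fun y hy ↦ (hΦder y hy.1).hasFDerivWithinAt) hinj F, himage]
    exact setIntegral_congr_set (sdiff_null_ae_eq_self (measure_singleton _)).symm
  -- the transplanted function
  set w : EuclideanSpace ℝ (Fin n) → ℝ := v ∘ Φ with hw
  have hK : IsCompact (radialMap P '' tsupport v) := by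
    refine IsCompact.image_of_continuousOn hvc fun x hx ↦ ContinuousAt.continuousWithinAt ?_
    have hx' := hvs hx
    have hx0 : 0 < ‖x‖ := norm_pos_iff.mpr hx'.2
    have hP : ContinuousAt (fun z : EuclideanSpace ℝ (Fin n) ↦ P ‖z‖) x := by
      refine ContinuousAt.comp (g := XX (k + 1)) (f := fun z ↦ ‖z‖ / D)
        (continuousAt_XX _ (hIoc _ hx0 (by simpa using hx'.1))) (by fun_prop)
    exact (hP.div continuous_norm.continuousAt hx0.ne').smul continuousAt_id
  have hKA : radialMap P '' tsupport v ⊆ A := by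
    rintro _ ⟨x, hx, rfl⟩
    exact hAmem _ (by rw [(hΨne x (hvs hx)).2]; exact hvs hx)
  have hwsupp : Function.support w ⊆ radialMap P '' tsupport v := fun y hy ↦ by
    have h1 : Φ y ∈ tsupport v := subset_tsupport v hy
    exact ⟨Φ y, h1, hΨΦ y (hΦ0 y (hvs h1).2)⟩
  have hwc : HasCompactSupport w := .of_support_subset_isCompact hK hwsupp
  have hwts : tsupport w ⊆ A := (closure_minimal hwsupp hK.isClosed).trans hKA
  have hw0 : (0 : EuclideanSpace ℝ (Fin n)) ∉ tsupport w := fun h ↦ (hwts h).1 rfl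
  have hv1 : ContDiff ℝ 1 v := hv.of_le (by exact_mod_cast le_top)
  have hwC : ContDiff ℝ 1 w := contDiff_of_forall_mem_tsupport fun y hy ↦ by
    have hy0 := (hwts hy).1
    exact hv1.contDiffAt.comp y (contDiffAt_radialMap hy0
      (contDiffAt_const.mul (contDiffAt_invXX _ (norm_pos_iff.mpr hy0))))
  have hdet : ∀ y ∈ A, |(radialFDeriv R (R' ‖y‖) y).det| =
      (R ‖y‖ / ‖y‖) ^ (n : ℝ) / (YY k (R ‖y‖ / D) * ‖y‖) ∧
      YY (k + 1) (R ‖y‖ / D) = YY k (R ‖y‖ / D) * ‖y‖ ∧ 0 < YY k (R ‖y‖ / D) := by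
    intro y hy
    have hρ : 0 < ‖y‖ := norm_pos_iff.mpr hy.1
    have hr := hRpos _ hρ
    have hI := hIoc _ hr hy.2
    have hY : YY (k + 1) (R ‖y‖ / D) = YY k (R ‖y‖ / D) * ‖y‖ := by
      rw [YY_succ]
      congr 1
      exact hPR ‖y‖
    have hYp := (YY_mem_Ioc k hI).1
    refine ⟨?_, hY, hYp⟩
    rw [det_radialFDeriv hy.1 hr.ne', hfr, Real.rpow_natCast]
    simp only [hR'def, hY]
    rw [abs_of_nonneg (by positivity)]
    field_simp
  have hright : ∫ x in Metric.ball (0 : EuclideanSpace ℝ (Fin n)) 1,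
      ‖x‖ ^ (-(n : ℝ)) * |v x| ^ pstar * YY k (‖x‖ / D) *
        (XX (k + 1) (‖x‖ / D)) ^ (1 + pstar / p) =
      ∫ y, ‖y‖ ^ (pstar / p - n) * |w y| ^ pstar := by
    rw [hball, ← setIntegral_eq_integral_of_forall_compl_eq_zero
      (s := A) (μ := volume)]
    · refine setIntegral_congr_fun hAmeas fun y hy ↦ ?_
      obtain ⟨h1, h2, h3⟩ := hdet y hy
      have hρ : 0 < ‖y‖ := norm_pos_iff.mpr hy.1
      have hr := hRpos _ hρ
      have hX : XX (k + 1) (R ‖y‖ / D) = ‖y‖ := hPR ‖y‖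
      simp only [h1, hΦnorm y hy.1, hX, smul_eq_mul, hw, Function.comp_apply]
      rw [Real.div_rpow hr.le hρ.le, Real.rpow_neg hr.le, Real.rpow_add hρ, Real.rpow_one,
        Real.rpow_sub hρ]
      have : R ‖y‖ ^ (n : ℝ) ≠ 0 := by positivity
      field_simp
    · intro y hy
      have : w y = 0 := image_eq_zero_of_notMem_tsupport fun h ↦ hy (hwts h)
      simp [this, hq.ne']
  have hdv : Continuous (fderiv ℝ v) := hv1.continuous_fderiv one_ne_zero
  have hdw : Continuous (fderiv ℝ w) := hwC.continuous_fderiv one_ne_zero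
  have htsv : tsupport (fun x ↦ ‖fderiv ℝ v x‖ ^ p) ⊆ tsupport v :=
    (tsupport_rpow_norm_subset _ hp0).trans (tsupport_fderiv_subset ℝ)
  have htsw : tsupport (fun x ↦ ‖fderiv ℝ w x‖ ^ p) ⊆ tsupport w :=
    (tsupport_rpow_norm_subset _ hp0).trans (tsupport_fderiv_subset ℝ)
  have hvint : Integrable (fun x : EuclideanSpace ℝ (Fin n) ↦
      ‖x‖ ^ (p - n) * ‖fderiv ℝ v x‖ ^ p * (YY (k + 1) (‖x‖ / D)) ^ (2 - p) *
        (YY k (‖x‖ / D)) ^ (-1 : ℝ)) := by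
    refine Continuous.integrable_of_hasCompactSupport ?_
      (hvc.mono' (subset_closure.trans htsv)).mul_left.mul_right.mul_right
    refine continuous_of_tsupport fun x hx ↦ ?_
    have hx' := hvs (htsv (tsupport_mul_subset_right (tsupport_mul_subset_left
      (tsupport_mul_subset_left hx))))
    have hx0 : 0 < ‖x‖ := norm_pos_iff.mpr hx'.2
    have hI := hIoc _ hx0 (by simpa using hx'.1)
    have hY : ∀ j, ContinuousAt (fun z : EuclideanSpace ℝ (Fin n) ↦ YY j (‖z‖ / D)) x := fun j ↦
      ContinuousAt.comp (g := YY j) (f := fun z ↦ ‖z‖ / D) (continuousAt_YY j hI) (by fun_prop)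
    have hY0 : ∀ j, YY j (‖x‖ / D) ≠ 0 := fun j ↦ (YY_mem_Ioc j hI).1.ne'
    exact (((continuous_norm.continuousAt.rpow_const (.inl hx0.ne')).mul
      (hdv.norm.continuousAt.rpow_const (.inr hp0.le))).mul
      ((hY _).rpow_const (.inl (hY0 _)))).mul ((hY _).rpow_const (.inl (hY0 _)))
  have hwint : Integrable (fun y : EuclideanSpace ℝ (Fin n) ↦
      ‖y‖ ^ (p + 1 - n) * ‖fderiv ℝ w y‖ ^ p) :=
    (continuous_norm_rpow_mul (hdw.norm.rpow_const fun _ ↦ .inr hp0.le)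
      (fun h ↦ hw0 (htsw h)) _).integrable_of_hasCompactSupport
      (hwc.mono' (subset_closure.trans htsw)).mul_left
  have hleft : ∫ y, ‖y‖ ^ (p + 1 - n) * ‖fderiv ℝ w y‖ ^ p ≤
      ∫ x in Metric.ball (0 : EuclideanSpace ℝ (Fin n)) 1,
        ‖x‖ ^ (p - n) * ‖fderiv ℝ v x‖ ^ p * (YY (k + 1) (‖x‖ / D)) ^ (2 - p) *
          (YY k (‖x‖ / D)) ^ (-1 : ℝ) := by
    rw [hball, ← setIntegral_eq_integral_of_forall_compl_eq_zero
      (s := A) (μ := volume)]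
    · refine setIntegral_mono_on hwint.integrableOn
        ((integrableOn_image_iff_integrableOn_abs_det_fderiv_smul volume hAmeas
          (fun y hy ↦ (hΦder y hy.1).hasFDerivWithinAt) hinj _).mp hvint.integrableOn)
        hAmeas fun y hy ↦ ?_
      obtain ⟨h1, h2, h3⟩ := hdet y hy
      have hρ : 0 < ‖y‖ := norm_pos_iff.mpr hy.1
      have hr := hRpos _ hρ
      have hYle : YY k (R ‖y‖ / D) * ‖y‖ ≤ 1 := h2 ▸ (YY_mem_Ioc _ (hIoc _ hr hy.2)).2
      have hR' : R' ‖y‖ = R ‖y‖ / (‖y‖ * (YY k (R ‖y‖ / D) * ‖y‖)) := by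
        simp only [hR'def, h2]
      have hslope : R ‖y‖ / ‖y‖ ≤ R' ‖y‖ := by
        rw [hR']
        gcongr
        exact mul_le_of_le_one_right hρ.le hYle
      have hchain : ‖fderiv ℝ w y‖ ≤ ‖fderiv ℝ v (Φ y)‖ * R' ‖y‖ := by
        rw [hw, ((hv1.differentiable one_ne_zero (Φ y)).hasFDerivAt.comp y (hΦder y hy.1)).fderiv]
        exact (ContinuousLinearMap.opNorm_comp_le _ _).trans
          (by gcongr; exact norm_radialFDeriv_le hy.1 hr.le hslope)
      have hpow := Real.rpow_le_rpow (norm_nonneg _) hchain hp0.le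
      refine (mul_le_mul_of_nonneg_left hpow (by positivity)).trans_eq ?_
      simp only [h1, h2, hΦnorm y hy.1, smul_eq_mul]
      generalize YY k (R ‖y‖ / D) = Y at *
      rw [hR', Real.mul_rpow (norm_nonneg _) (by positivity), Real.div_rpow hr.le (by positivity),
        Real.mul_rpow hρ.le (by positivity), Real.div_rpow hr.le hρ.le, Real.rpow_sub hr,
        Real.rpow_sub hρ, Real.rpow_add hρ, Real.rpow_one, Real.rpow_sub (by positivity),
        Real.mul_rpow h3.le hρ.le, Real.rpow_neg_one, Real.rpow_two]
      have e1 : R ‖y‖ ^ (n : ℝ) ≠ 0 := by positivity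
      have e2 : ‖y‖ ^ (n : ℝ) ≠ 0 := by positivity
      have e3 : ‖y‖ ^ p ≠ 0 := by positivity
      have e4 : Y ^ p ≠ 0 := by positivity
      field_simp
    · intro y hy
      have : ‖fderiv ℝ w y‖ ^ p = 0 := image_eq_zero_of_notMem_tsupport
        (f := fun y ↦ ‖fderiv ℝ w y‖ ^ p) fun h ↦ hy (hwts (htsw h))
      simp [this]
  rw [hright, ge_iff_le, inv_mul_le_iff₀ hC]
  exact (hckn w hwC hwc hw0).trans (by gcongr)
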